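/- Let K=(S,AP,→,L) be a Kripke structure, π a partition of S, 𝐁 a union of some of the blocks of π, and B ∈ π a block with B ⊆ 𝐁. Let B' ∈ π be a block with split(B',𝐁) = B'. Then split(cosplit(B',B), 𝐁 \ B) = cosplit(B',B); in other words, after splitting B' under B, the subblock cosplit(B',B) is stable under 𝐁 \ B because every one of its states has a path staying inside cosplit(B',B) that reaches 𝐁 \ B. -/

import Mathlib

/-- A Kripke structure: states, atomic propositions, a total transition
relation and a state labelling. -/
structure Kripke (S AP : Type*) where
  tr : S → S → Prop
  L : S → Set AP
  total : ∀ s : S, ∃ t : S, tr s t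

variable {S AP : Type*}

/-- `R` is a divergence-blind stuttering equivalence. -/
def IsDBS (K : Kripke S AP) (R : S → S → Prop) : Prop :=
  Symmetric R ∧ ∀ s t, R s t →
    K.L s = K.L t ∧
    ∀ s', K.tr s s' → ∃ (k : ℕ) (f : ℕ → S), f 0 = t ∧
      (∀ i < k, K.tr (f i) (f (i + 1))) ∧
      (∀ i < k, R s (f i)) ∧ R s' (f k)

/-- Divergence-blind stuttering equivalence of two states. -/
def DBSEq (K : Kripke S AP) (s t : S) : Prop :=
  ∃ R, IsDBS K R ∧ R s t

/-- `π` is a partition of the set of all states. -/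
def IsPartition (π : Set (Set S)) : Prop :=
  (∀ B ∈ π, B.Nonempty) ∧
  (∀ B ∈ π, ∀ B' ∈ π, B ≠ B' → B ∩ B' = ∅) ∧
  ⋃₀ π = Set.univ

/-- `split C Bu`: the states in `C` from which a path inside `C` reaches `Bu`. -/
def split (K : Kripke S AP) (C Bu : Set S) : Set S :=
  {s ∈ C | ∃ (k : ℕ) (f : ℕ → S), f 0 = s ∧
    (∀ i < k, K.tr (f i) (f (i + 1))) ∧ (∀ i < k, f i ∈ C) ∧ f k ∈ Bu}

def cosplit (K : Kripke S AP) (C Bu : Set S) : Set S :=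
  C \ split K C Bu

/-- A block `C` is unstable under `Bu` iff both `split` and `cosplit` are nonempty. -/
def Unstable (K : Kripke S AP) (C Bu : Set S) : Prop :=
  (split K C Bu).Nonempty ∧ (cosplit K C Bu).Nonempty

/-- The bottom states of a block: no outgoing transition inside the block. -/
def bottom (K : Kripke S AP) (B : Set S) : Set S :=
  {s ∈ B | ∀ s' ∈ B, ¬ K.tr s s'}

/-- A partition is cycle-free: no block contains a cycle staying inside it. -/
def CycleFree (K : Kripke S AP) (π : Set (Set S)) : Prop :=
  ¬ ∃ B ∈ π, ∃ (k : ℕ) (f : ℕ → S),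
    (∀ i ≤ k, f i ∈ B) ∧ (∀ i < k, K.tr (f i) (f (i + 1))) ∧ K.tr (f k) (f 0)

/-- `π` respects divergence-blind stuttering equivalence. -/
def Respects (K : Kripke S AP) (π : Set (Set S)) : Prop :=
  ∀ s t, DBSEq K s t → ∃ B ∈ π, s ∈ B ∧ t ∈ B

/-- The refinement of `π` under `Bu`: every unstable block is replaced by
its `split` and `cosplit` parts. -/
def refinement (K : Kripke S AP) (π : Set (Set S)) (Bu : Set S) : Set (Set S) :=
  {B ∈ π | ¬ Unstable K B Bu} ∪
  {C | ∃ B' ∈ π, Unstable K B' Bu ∧ (C = split K B' Bu ∨ C = cosplit K B' Bu)}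

theorem mem_split_of_mem {K : Kripke S AP} {C Bu : Set S} {s : S} (hs : s ∈ C) (hb : s ∈ Bu) :
    s ∈ split K C Bu :=
  ⟨hs, 0, fun _ => s, rfl, by simp, by simp, hb⟩

theorem mem_split_of_tr_mem {K : Kripke S AP} {C Bu : Set S} {s t : S} (hs : s ∈ C)
    (hst : K.tr s t) (ht : t ∈ Bu) : s ∈ split K C Bu := by
  refine ⟨hs, 1, fun i => if i = 0 then s else t, rfl, ?_, ?_, ht⟩ <;>
    intro i hi <;> obtain rfl : i = 0 := by omega
  exacts [hst, hs]

theorem mem_split_of_tr_split {K : Kripke S AP} {C Bu : Set S} {s t : S} (hs : s ∈ C)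
    (hst : K.tr s t) (ht : t ∈ split K C Bu) : s ∈ split K C Bu := by
  obtain ⟨-, k, f, rfl, htr, hC, hk⟩ := ht
  refine ⟨hs, k + 1, fun i => i.casesOn s f, rfl, ?_, ?_, hk⟩
  · rintro (_ | i) hi
    exacts [hst, htr i (by omega)]
  · rintro (_ | i) hi
    exacts [hs, hC i (by omega)]

/-- A path inside `C` that starts in `cosplit K C Bu` stays in it. -/
theorem path_mem_cosplit {K : Kripke S AP} {C Bu : Set S} {k : ℕ} {f : ℕ → S}
    (h0 : f 0 ∈ cosplit K C Bu) (htr : ∀ i < k, K.tr (f i) (f (i + 1)))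
    (hC : ∀ i < k, f i ∈ C) : ∀ i < k, f i ∈ cosplit K C Bu := by
  intro i hi
  induction i with
  | zero => exact h0
  | succ i ih =>
    have hi' : i < k := by omega
    exact ⟨hC _ hi, fun h => (ih hi').2 (mem_split_of_tr_split (hC i hi') (htr i hi') h)⟩

/-- If every state of `B'` can reach the constellation `⋃₀ σ` inside `B'`
(i.e. `split B' (⋃₀ σ) = B'`) and `B ∈ π` is a block contained in `⋃₀ σ`, then
after splitting `B'` under `B`, the subblock `cosplit B' B` is stable under
`⋃₀ σ \ B`: every one of its states has a path staying inside `cosplit B' B`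
reaching `⋃₀ σ \ B`. -/
theorem cosplit_stable_under_coconstellation [Fintype S] [Fintype AP]
    (K : Kripke S AP) (π : Set (Set S))
    (hpart : IsPartition π)
    (σ : Set (Set S)) (hσ : σ ⊆ π)
    (B : Set S) (hB : B ∈ π) (hBsub : B ⊆ ⋃₀ σ)
    (B' : Set S) (hB' : B' ∈ π)
    (hsplit : split K B' (⋃₀ σ) = B') :
    split K (cosplit K B' B) (⋃₀ σ \ B) = cosplit K B' B := by
  refine Set.Subset.antisymm (fun s hs => hs.1) fun s hs => ?_
  have hs' : s ∈ split K B' (⋃₀ σ) := hsplit.symm ▸ hs.1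
  obtain ⟨-, k, f, rfl, htr, hC, hk⟩ := hs'
  have hmem := path_mem_cosplit hs htr hC
  refine ⟨hs, k, f, rfl, htr, hmem, hk, fun hkB => ?_⟩
  cases k with
  | zero => exact hs.2 (mem_split_of_mem hs.1 hkB)
  | succ k =>
    have hlt := Nat.lt_succ_self k
    exact (hmem k hlt).2 (mem_split_of_tr_mem (hC k hlt) (htr k hlt) hkB)
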